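/- Let τ ≥ 0 and ℓ ≥ 2 be integers. For all integers d ≥ 0 and t with 1 ≤ t ≤ ℓ there exists an integer c ≥ 0 with the following property. Let G be a graph such that χ³(G) ≤ τ and every induced subgraph J of G with ω(J) < ω(G) has chromatic number at most τ. Let S = (L_0, L_1, …, L_k, s) be a shower in G whose floor has chromatic number more than c. Then the d-jetset of S is (t,ℓ)-complete. -/

import Mathlib

open SimpleGraph

variable {V : Type*}

/-- The set of vertices at `G`-distance at most `ρ` from `v`. -/
def closedNbhd (G : SimpleGraph V) (v : V) (ρ : ℕ) : Set V :=
  {u | G.Reachable v u ∧ G.dist v u ≤ ρ}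

/-- `χ^ρ(G)`. -/
noncomputable def chiRho (G : SimpleGraph V) (ρ : ℕ) : ℕ∞ :=
  ⨆ v : V, (G.induce (closedNbhd G v ρ)).chromaticNumber

/-- `B` covers `C`: they are disjoint and every vertex of `C` has a neighbour in `B`. -/
def Covers (G : SimpleGraph V) (B C : Set V) : Prop :=
  Disjoint B C ∧ ∀ v ∈ C, ∃ b ∈ B, G.Adj b v

/-- `(L 0, L 1, …, L k, s)` is a shower in `G`. -/
def IsShower (G : SimpleGraph V) (k : ℕ) (L : ℕ → Set V) (s : V) : Prop :=
  1 ≤ k ∧ s ∈ L k ∧ (∃ z, L 0 = {z}) ∧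
  (∀ i ≤ k, ∀ j ≤ k, i ≠ j → Disjoint (L i) (L j)) ∧
  (∀ i, 1 ≤ i → i < k → Covers G (L (i - 1)) (L i)) ∧
  (∀ i j, j ≤ k → i + 1 < j → ∀ v ∈ L j, ∀ u ∈ L i, ¬ G.Adj v u) ∧
  (G.induce (L k)).Connected

/-- The vertex set `L 0 ∪ ⋯ ∪ L k` of a shower. -/
def showerVtx (k : ℕ) (L : ℕ → Set V) : Set V :=
  ⋃ i ∈ Set.Iic k, L i

/-- The floor of a shower: the vertices of `L k` with a neighbour in `L (k-1)`. -/
def showerFloor (G : SimpleGraph V) (k : ℕ) (L : ℕ → Set V) : Set V :=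
  {v ∈ L k | ∃ u ∈ L (k - 1), G.Adj u v}

/-- A jet of the shower: an induced path of `G[L 0 ∪ ⋯ ∪ L k]` from the head to the
drain `s`. -/
def IsJet (G : SimpleGraph V) (k : ℕ) (L : ℕ → Set V) (s : V) {p : ℕ}
    (f : pathGraph (p + 1) ↪g G) : Prop :=
  Set.range f ⊆ showerVtx k L ∧ f 0 ∈ L 0 ∧ f (Fin.last p) = s

/-- A `d`-peripheral jet: some subset of the floor, anticomplete to the jet, has
chromatic number more than `d`. -/
def IsPeriphJet (G : SimpleGraph V) (k : ℕ) (L : ℕ → Set V) (s : V) (d : ℕ) {p : ℕ}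
    (f : pathGraph (p + 1) ↪g G) : Prop :=
  IsJet G k L s f ∧ ∃ X ⊆ showerFloor G k L,
    Disjoint X (Set.range f) ∧ (∀ a ∈ X, ∀ b ∈ Set.range f, ¬ G.Adj a b) ∧
    (d : ℕ∞) < (G.induce X).chromaticNumber

/-- The subgraph of `G` induced on `X` has a proper colouring with `n` colours. -/
def ColorableOn (G : SimpleGraph V) (X : Set V) (n : ℕ) : Prop :=
  ∃ f : V → ℕ, (∀ v ∈ X, f v < n) ∧ ∀ u ∈ X, ∀ v ∈ X, G.Adj u v → f u ≠ f v

theorem colorableOn_iff (G : SimpleGraph V) (X : Set V) (n : ℕ) :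
    ColorableOn G X n ↔ (G.induce X).chromaticNumber ≤ (n : ℕ∞) := by
  classical
  rw [chromaticNumber_le_iff_colorable]
  constructor
  · rintro ⟨f, hf, hadj⟩
    exact ⟨Coloring.mk (fun v => (⟨f v.1, hf v.1 v.2⟩ : Fin n)) (by
      intro u v huv h
      exact hadj u.1 u.2 v.1 v.2 huv (by simpa using h))⟩
  · rintro ⟨c⟩
    refine ⟨fun v => if h : v ∈ X then (c ⟨v, h⟩ : ℕ) else 0, ?_, ?_⟩
    · intro v hv
      simp [hv]
    · intro u hu v hv huv
      simp only [hu, hv, dif_pos]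
      intro h
      exact c.valid (v := ⟨u, hu⟩) (w := ⟨v, hv⟩) huv (Fin.ext h)

theorem lt_chromaticNumber_iff (G : SimpleGraph V) (X : Set V) (n : ℕ) :
    (n : ℕ∞) < (G.induce X).chromaticNumber ↔ ¬ ColorableOn G X n := by
  rw [colorableOn_iff, not_le]

namespace ColorableOn

variable {G H : SimpleGraph V} {X Y : Set V} {m n : ℕ}

theorem mono (h : ColorableOn G X n) (hYX : Y ⊆ X) (hnm : n ≤ m) : ColorableOn G Y m := by
  obtain ⟨f, hf, hadj⟩ := h
  exact ⟨f, fun v hv => (hf v (hYX hv)).trans_le hnm,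
    fun u hu v hv => hadj u (hYX hu) v (hYX hv)⟩

theorem of_le (h : ColorableOn G X n) (hHG : H ≤ G) : ColorableOn H X n := by
  obtain ⟨f, hf, hadj⟩ := h
  exact ⟨f, hf, fun u hu v hv huv => hadj u hu v hv (hHG huv)⟩

/-- Pieces without edges between them can be coloured independently. -/
theorem glue {ι : Type*} (g : V → ι) (hg : ∀ u ∈ X, ∀ v ∈ X, G.Adj u v → g u = g v)
    (h : ∀ u ∈ X, ColorableOn G {v ∈ X | g v = g u} n) : ColorableOn G X n := by
  classical
  have h' : ∀ i : ι, ∃ f : V → ℕ, (∀ v ∈ X, g v = i → f v < n) ∧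
      ∀ u ∈ X, ∀ v ∈ X, g u = i → g v = i → G.Adj u v → f u ≠ f v := by
    intro i
    by_cases hi : ∃ u ∈ X, g u = i
    · obtain ⟨u, hu, rfl⟩ := hi
      obtain ⟨f, hf, hadj⟩ := h u hu
      exact ⟨f, fun v hv hvi => hf v ⟨hv, hvi⟩,
        fun a ha b hb hai hbi => hadj a ⟨ha, hai⟩ b ⟨hb, hbi⟩⟩
    · push Not at hi
      exact ⟨fun _ => 0, fun v hv hvi => absurd hvi (hi v hv),
        fun a ha _ _ hai => absurd hai (hi a ha)⟩
  choose F hF hadj using h'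
  refine ⟨fun v => F (g v) v, fun v hv => hF _ v hv rfl, ?_⟩
  intro u hu v hv huv
  have := hg u hu v hv huv
  simp only
  rw [← this]
  exact hadj _ u hu v hv rfl this.symm huv

/-- If a function with `m` values has fibres that are `n`-colourable, the whole set is
`m * n`-colourable. -/
theorem of_fibres (g : V → ℕ) (hg : ∀ v ∈ X, g v < m)
    (h : ∀ i < m, ColorableOn G {v ∈ X | g v = i} n) : ColorableOn G X (m * n) := by
  classical
  have h' : ∀ i : ℕ, ∃ f : V → ℕ, i < m → (∀ v ∈ X, g v = i → f v < n) ∧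
      ∀ u ∈ X, ∀ v ∈ X, g u = i → g v = i → G.Adj u v → f u ≠ f v := by
    intro i
    by_cases hi : i < m
    · obtain ⟨f, hf, hadj⟩ := h i hi
      exact ⟨f, fun _ => ⟨fun v hv hvi => hf v ⟨hv, hvi⟩,
        fun a ha b hb hai hbi => hadj a ⟨ha, hai⟩ b ⟨hb, hbi⟩⟩⟩
    · exact ⟨fun _ => 0, fun h => absurd h hi⟩
  choose F hF using h'
  refine ⟨fun v => g v * n + F (g v) v, ?_, ?_⟩
  · intro v hv
    have h1 := hg v hv
    have h2 := (hF _ h1).1 v hv rfl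
    calc g v * n + F (g v) v < g v * n + n := by omega
      _ = (g v + 1) * n := by ring
      _ ≤ m * n := Nat.mul_le_mul_right n h1
  · intro u hu v hv huv heq
    have hu2 := (hF _ (hg u hu)).1 u hu rfl
    have hv2 := (hF _ (hg v hv)).1 v hv rfl
    have hn : 0 < n := by omega
    simp only at heq
    have e1 : (g u * n + F (g u) u) / n = g u := by
      rw [mul_comm, Nat.mul_add_div hn, Nat.div_eq_of_lt hu2, add_zero]
    have e2 : (g v * n + F (g v) v) / n = g v := by
      rw [mul_comm, Nat.mul_add_div hn, Nat.div_eq_of_lt hv2, add_zero]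
    have hgg : g u = g v := by rw [← e1, heq, e2]
    refine (hF _ (hg u hu)).2 u hu v hv rfl hgg.symm huv ?_
    rw [hgg] at heq ⊢
    omega

theorem union (hX : ColorableOn G X m) (hY : ColorableOn G Y n) :
    ColorableOn G (X ∪ Y) (m + n) := by
  classical
  obtain ⟨f, hf, hfa⟩ := hX
  obtain ⟨g, hg, hga⟩ := hY
  refine ⟨fun v => if v ∈ X then f v else m + g v, ?_, ?_⟩
  · intro v hv
    by_cases h : v ∈ X
    · have := hf v h
      simp only [h, if_true]
      omega
    · have := hg v (hv.resolve_left h)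
      simp only [h, if_false]
      omega
  · intro u hu v hv huv
    by_cases h : u ∈ X <;> by_cases h' : v ∈ X <;> simp only [h, h', if_true, if_false]
    · exact hfa u h v h' huv
    · have := hf u h
      omega
    · have := hf v h'
      omega
    · have := hga u (hu.resolve_left h) v (hv.resolve_left h') huv
      omega

theorem of_empty (h : ∀ v, v ∉ X) : ColorableOn G X n :=
  ⟨fun _ => 0, fun v hv => absurd hv (h v), fun u hu => absurd hu (h u)⟩

/-- Deleting an `m`-colourable set lowers the chromatic number by at most `m`. -/
theorem not_diff (hX : ¬ ColorableOn G X (m + n)) (hY : ColorableOn G Y m) :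
    ¬ ColorableOn G (X \ Y) n := by
  intro h
  refine hX ((hY.union h).mono ?_ le_rfl)
  intro v hv
  by_cases hvY : v ∈ Y
  · exact Or.inl hvY
  · exact Or.inr ⟨hv, hvY⟩

end ColorableOn

/-- Adjacency inside a set. -/
def AdjIn (G : SimpleGraph V) (X : Set V) (a b : V) : Prop :=
  G.Adj a b ∧ a ∈ X ∧ b ∈ X

/-- Any two vertices of `X` are joined by a path of `G` inside `X`. -/
def ConnectedOn (G : SimpleGraph V) (X : Set V) : Prop :=
  ∀ a ∈ X, ∀ b ∈ X, Relation.ReflTransGen (AdjIn G X) a b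

/-- The vertices of `X` joined to `a` by a path of `G` inside `X`. -/
def componentOn (G : SimpleGraph V) (X : Set V) (a : V) : Set V :=
  {b ∈ X | Relation.ReflTransGen (AdjIn G X) a b}

theorem adjIn_reflTransGen_symm {G : SimpleGraph V} {X : Set V} {a b : V}
    (h : Relation.ReflTransGen (AdjIn G X) a b) : Relation.ReflTransGen (AdjIn G X) b a := by
  induction h with
  | refl => exact .refl
  | tail h1 h2 ih => exact .head ⟨h2.1.symm, h2.2.2, h2.2.1⟩ ih

theorem connectedOn_componentOn (G : SimpleGraph V) (X : Set V) (a : V) :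
    ConnectedOn G (componentOn G X a) := by
  have key : ∀ b, Relation.ReflTransGen (AdjIn G X) a b →
      Relation.ReflTransGen (AdjIn G (componentOn G X a)) a b := by
    intro b hb
    induction hb with
    | refl => exact .refl
    | tail h1 h2 ih => exact ih.tail ⟨h2.1, ⟨h2.2.1, h1⟩, ⟨h2.2.2, h1.tail h2⟩⟩
  intro b hb c hc
  exact (adjIn_reflTransGen_symm (key b hb.2)).trans (key c hc.2)

/-- A set that is not `n`-colourable has a component that is not `n`-colourable. -/
theorem exists_component {G : SimpleGraph V} {X : Set V} {n : ℕ} (h : ¬ ColorableOn G X n) :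
    ∃ a ∈ X, ¬ ColorableOn G (componentOn G X a) n := by
  by_contra! hcon
  refine h (ColorableOn.glue (componentOn G X) ?_ ?_)
  · intro u hu v hv huv
    ext w
    have huv' : AdjIn G X u v := ⟨huv, hu, hv⟩
    have hvu' : AdjIn G X v u := ⟨huv.symm, hv, hu⟩
    exact ⟨fun hw => ⟨hw.1, .head hvu' hw.2⟩, fun hw => ⟨hw.1, .head huv' hw.2⟩⟩
  · intro u hu
    refine (hcon u hu).mono ?_ le_rfl
    rintro v ⟨hv, hvu⟩
    rw [← hvu]
    exact ⟨hv, .refl⟩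

theorem mem_componentOn_of_adj {G : SimpleGraph V} {X : Set V} {a b c : V}
    (hb : b ∈ componentOn G X a) (hc : c ∈ X) (hbc : G.Adj b c) : c ∈ componentOn G X a :=
  ⟨hc, hb.2.tail ⟨hbc, hb.1, hc⟩⟩

/-- A connected set has an edge leaving every nonempty proper subset. -/
theorem ConnectedOn.exists_adj {G : SimpleGraph V} {X A : Set V} (hX : ConnectedOn G X)
    {a b : V} (ha : a ∈ A) (haX : a ∈ X) (hb : b ∉ A) (hbX : b ∈ X) :
    ∃ x ∈ A, ∃ y ∉ A, x ∈ X ∧ y ∈ X ∧ G.Adj x y := by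
  have h := hX a haX b hbX
  clear hbX
  induction h with
  | refl => exact absurd ha hb
  | @tail y z h1 h2 ih =>
    by_cases hy : y ∈ A
    · exact ⟨y, hy, z, hb, h2.2.1, h2.2.2, h2.1⟩
    · exact ih hy

theorem connectedOn_insert {G : SimpleGraph V} {X : Set V} (hX : ConnectedOn G X) {v x : V}
    (hx : x ∈ X) (hvx : G.Adj v x) : ConnectedOn G (insert v X) := by
  have mono : ∀ {a b}, Relation.ReflTransGen (AdjIn G X) a b →
      Relation.ReflTransGen (AdjIn G (insert v X)) a b := by
    intro a b h
    induction h with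
    | refl => exact .refl
    | tail _ h2 ih => exact ih.tail ⟨h2.1, Or.inr h2.2.1, Or.inr h2.2.2⟩
  have key : ∀ a ∈ insert v X, Relation.ReflTransGen (AdjIn G (insert v X)) v a := by
    rintro a (rfl | ha)
    · exact .refl
    · exact .head ⟨hvx, Or.inl rfl, Or.inr hx⟩ (mono (hX x hx a ha))
  exact fun a ha b hb => (adjIn_reflTransGen_symm (key a ha)).trans (key b hb)

theorem ConnectedOn.induce_connected {G : SimpleGraph V} {X : Set V} (hX : ConnectedOn G X)
    (hne : X.Nonempty) : (G.induce X).Connected := by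
  have key : ∀ a b, Relation.ReflTransGen (AdjIn G X) a b → ∀ ha : a ∈ X, ∀ hb : b ∈ X,
      (G.induce X).Reachable ⟨a, ha⟩ ⟨b, hb⟩ := by
    intro a b h ha
    induction h with
    | refl => exact fun _ => Reachable.refl _
    | tail h1 h2 ih =>
      intro hb
      refine (ih h2.2.1).trans (Adj.reachable ?_)
      exact h2.1
  obtain ⟨x, hx⟩ := hne
  have : Nonempty X := ⟨⟨x, hx⟩⟩
  exact ⟨fun a b => key a b (hX a a.2 b b.2) a.2 b.2⟩

/-- Let `G[C]` be graded by `T` into `w`-colourable classes, and let `H` be a subgraph with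
large chromatic number. Then some edge `uv` of `H` and some connected set `X` of large chromatic
number, later than `u` and `v`, are such that `v` has a neighbour in `X` and `u` has none. -/
theorem exists_edge_of_grading [Finite V] {G H : SimpleGraph V} (hHG : H ≤ G) {C : Set V}
    (T : V → ℕ) {w c n : ℕ} (hw : ∀ i, ColorableOn G {v ∈ C | T v = i} w)
    (hn : ∀ v, ColorableOn G {u | G.Adj v u} n)
    (hbig : ¬ ColorableOn H C (w + (c + n) + n)) :
    ∃ u ∈ C, ∃ v ∈ C, H.Adj u v ∧ ∃ X ⊆ C, ConnectedOn G X ∧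
      (∀ x ∈ X, T u < T x ∧ T v < T x) ∧ (∃ x ∈ X, G.Adj v x) ∧ (∀ x ∈ X, ¬ G.Adj u x) ∧
      ¬ ColorableOn G X c := by
  classical
  by_contra! hcon
  set A : Set V := {v ∈ C | ∃ X ⊆ C, ConnectedOn G X ∧ (∀ x ∈ X, T v < T x) ∧
    (∃ x ∈ X, G.Adj v x) ∧ ¬ ColorableOn G X (c + n)} with hA
  have hCA : ColorableOn G (C \ A) (w + (c + n)) := by
    by_contra hnot
    obtain ⟨a, ha, hQ⟩ := exists_component hnot
    set Q := componentOn G (C \ A) a with hQdef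
    have haQ : a ∈ Q := ⟨ha, .refl⟩
    obtain ⟨b, hbQ, hbmin⟩ := Set.exists_min_image Q T (Set.toFinite Q) ⟨a, haQ⟩
    have hQC : Q ⊆ C := fun x hx => hx.1.1
    have hnot' : ¬ ColorableOn G (Q \ {v ∈ C | T v = T b}) (c + n) :=
      ColorableOn.not_diff hQ (hw (T b))
    obtain ⟨e, he, hQ'⟩ := exists_component hnot'
    set Q' := componentOn G (Q \ {v ∈ C | T v = T b}) e
    have heQ' : e ∈ Q' := ⟨he, .refl⟩
    have hbQ' : b ∉ Q' := fun h => h.1.2 ⟨hQC hbQ, rfl⟩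
    obtain ⟨x, hx, y, hy, -, hyQ, hxy⟩ :=
      (connectedOn_componentOn G _ a).exists_adj heQ' he.1 hbQ' hbQ
    have hyT : T y = T b := by
      by_contra hne
      exact hy (mem_componentOn_of_adj hx ⟨hyQ, fun h => hne h.2⟩ hxy)
    refine hyQ.1.2 ⟨hQC hyQ, Q', fun z hz => hQC hz.1.1, connectedOn_componentOn G _ e, ?_,
      ⟨x, hx, hxy.symm⟩, hQ'⟩
    intro z hz
    have h1 := hbmin z hz.1.1
    have h2 : T z ≠ T b := fun h => hz.1.2 ⟨hQC hz.1.1, h⟩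
    omega
  have hAn : ColorableOn H A n := by
    by_contra hnot
    obtain ⟨a, ha, hZ⟩ := exists_component hnot
    set Z := componentOn H A a
    have haZ : a ∈ Z := ⟨ha, .refl⟩
    obtain ⟨z, hzZ, hzmax⟩ := Set.exists_max_image Z T (Set.toFinite Z) ⟨a, haZ⟩
    have hZC : Z ⊆ C := fun x hx => hx.1.1
    have hZconn : ConnectedOn H Z := connectedOn_componentOn H _ a
    obtain ⟨-, X, hXC, hXconn, hXT, ⟨x, hxX, hzx⟩, hXbig⟩ := hzZ.1
    have closure : ∀ Y ⊆ X, ConnectedOn G Y → ¬ ColorableOn G Y c → ∀ p ∈ Z, ∀ q ∈ Z,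
        (∃ y ∈ Y, G.Adj p y) → ∃ y ∈ Y, G.Adj q y := by
      intro Y hY hYconn hYbig p hp q hq hpY
      by_contra hqY
      obtain ⟨v, hv, u, hu, hvZ, huZ, hvu⟩ :=
        hZconn.exists_adj (A := {p | ∃ y ∈ Y, G.Adj p y}) hpY hp hqY hq
      refine hYbig (hcon u (hZC huZ) v (hZC hvZ) hvu.symm Y (hY.trans hXC) hYconn ?_ hv ?_)
      · intro y hy
        have := hXT y (hY hy)
        exact ⟨(hzmax u huZ).trans_lt this, (hzmax v hvZ).trans_lt this⟩
      · exact fun y hy h => hu ⟨y, hy, h⟩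
    have hX' : ¬ ColorableOn G (X \ {u | G.Adj z u}) c :=
      ColorableOn.not_diff (by rwa [add_comm] at hXbig) (hn z)
    obtain ⟨e, he, hX'big⟩ := exists_component hX'
    set X' := componentOn G (X \ {u | G.Adj z u}) e
    have heX' : e ∈ X' := ⟨he, .refl⟩
    have hX'X : X' ⊆ X := fun y hy => hy.1.1
    have hX'conn : ConnectedOn G X' := connectedOn_componentOn G _ e
    obtain ⟨f, hf, y, hy, -, hyX, hfy⟩ :=
      hXconn.exists_adj (A := X') heX' he.1 (fun h => h.1.2 hzx) hxX
    have hzy : G.Adj z y := by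
      by_contra hne
      exact hy (mem_componentOn_of_adj hf ⟨hyX, hne⟩ hfy)
    refine hZ (((hn y).mono ?_ le_rfl).of_le hHG)
    intro p hp
    obtain ⟨r, hr, hpr⟩ := closure (insert y X') (Set.insert_subset hyX hX'X)
      (connectedOn_insert hX'conn hf hfy.symm)
      (fun h => hX'big (h.mono (Set.subset_insert _ _) le_rfl)) z hzZ p hp
      ⟨y, Or.inl rfl, hzy⟩
    rcases hr with rfl | hr
    · exact hpr.symm
    · obtain ⟨r', hr', hzr'⟩ := closure X' hX'X hX'conn hX'big p hp z hzZ ⟨r, hr, hpr⟩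
      exact absurd hzr' hr'.1.2
  refine hbig (((hCA.of_le hHG).union hAn).mono ?_ le_rfl)
  intro v hv
  by_cases h : v ∈ A
  · exact Or.inr h
  · exact Or.inl ⟨hv, h⟩


/-- `y` is the end of an `n`-step walk from `x` all of whose vertices, except possibly the last,
lie in `S`. -/
def ReachIn (G : SimpleGraph V) (S : Set V) (x y : V) (n : ℕ) : Prop :=
  ∃ f : ℕ → V, f 0 = x ∧ f n = y ∧ (∀ i < n, f i ∈ S) ∧ ∀ i < n, G.Adj (f i) (f (i + 1))

/-- The vertices `f 0, …, f m` form an induced path, in this order. -/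
def IsIndPath (G : SimpleGraph V) (f : ℕ → V) (m : ℕ) : Prop :=
  ∀ i j, i < j → j ≤ m → f i ≠ f j ∧ (G.Adj (f i) (f j) ↔ i + 1 = j)

namespace ReachIn

variable {G : SimpleGraph V} {S S' : Set V} {x y z : V} {m n : ℕ}

theorem refl (x : V) : ReachIn G S x x 0 :=
  ⟨fun _ => x, rfl, rfl, by simp, by simp⟩

theorem step (hx : x ∈ S) (h : G.Adj x y) : ReachIn G S x y 1 :=
  ⟨fun i => if i = 0 then x else y, by simp, by simp, fun i hi => by
    obtain rfl : i = 0 := by omega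
    simpa using hx, fun i hi => by
    obtain rfl : i = 0 := by omega
    simpa using h⟩

theorem mono (h : ReachIn G S x y n) (hS : S ⊆ S') : ReachIn G S' x y n := by
  obtain ⟨f, h0, hn, hS', hadj⟩ := h
  exact ⟨f, h0, hn, fun i hi => hS (hS' i hi), hadj⟩

theorem trans (h : ReachIn G S x y m) (h' : ReachIn G S y z n) : ReachIn G S x z (m + n) := by
  obtain ⟨f, hf0, hfm, hfS, hfa⟩ := h
  obtain ⟨g, hg0, hgn, hgS, hga⟩ := h'
  refine ⟨fun i => if i < m then f i else g (i - m), ?_, ?_, ?_, ?_⟩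
  · by_cases hm : 0 < m
    · simp [hm, hf0]
    · obtain rfl : m = 0 := by omega
      simp [hg0, ← hfm, hf0]
  · simp [hgn]
  · intro i hi
    by_cases him : i < m
    · simpa [him] using hfS i him
    · simpa [him] using hgS (i - m) (by omega)
  · intro i hi
    by_cases him : i < m
    · by_cases him' : i + 1 < m
      · simpa [him, him'] using hfa i him
      · obtain rfl : i + 1 = m := by omega
        simpa [hg0, ← hfm] using hfa i him
    · have e : i + 1 - m = i - m + 1 := by omega
      have h1 : ¬ i + 1 < m := by omega
      simpa [him, h1, e] using hga (i - m) (by omega)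

theorem tail (h : ReachIn G S x y n) (hy : y ∈ S) (hyz : G.Adj y z) :
    ReachIn G S x z (n + 1) :=
  h.trans (step hy hyz)

/-- A shortest walk inside a set is an induced path. -/
theorem exists_isIndPath (h : ReachIn G S x y n) (hmin : ∀ m < n, ¬ ReachIn G S x y m) :
    ∃ f : ℕ → V, f 0 = x ∧ f n = y ∧ (∀ i < n, f i ∈ S) ∧ IsIndPath G f n ∧
      ∀ i ≤ n, ReachIn G S x (f i) i := by
  obtain ⟨f, hf0, hfn, hfS, hfa⟩ := h
  have pre : ∀ i ≤ n, ReachIn G S x (f i) i := fun i hi =>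
    ⟨f, hf0, rfl, fun j hj => hfS j (by omega), fun j hj => hfa j (by omega)⟩
  have suf : ∀ i ≤ n, ReachIn G S (f i) y (n - i) := fun i hi =>
    ⟨fun j => f (i + j), rfl, by simp [Nat.add_sub_of_le hi, hfn],
      fun j hj => hfS _ (by omega), fun j hj => hfa (i + j) (by omega)⟩
  refine ⟨f, hf0, hfn, hfS, ?_, pre⟩
  intro i j hij hj
  constructor
  · intro heq
    have h1 := pre i (by omega)
    rw [heq] at h1
    exact hmin _ (by omega) (h1.trans (suf j hj))
  · constructor
    · intro hadj
      by_contra hne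
      exact hmin _ (by omega) (((pre i (by omega)).tail (hfS i (by omega)) hadj).trans (suf j hj))
    · rintro rfl
      exact hfa i (by omega)

end ReachIn

namespace IsIndPath

variable {G : SimpleGraph V} {f g : ℕ → V} {m n : ℕ}

theorem trans (hf : IsIndPath G f m) (hg : IsIndPath G g n) (hfg : f m = g 0)
    (h : ∀ i < m, ∀ j ≤ n, 0 < j → f i ≠ g j ∧ ¬ G.Adj (f i) (g j)) :
    IsIndPath G (fun i => if i < m then f i else g (i - m)) (m + n) := by
  intro i j hij hj
  by_cases hi : i < m
  · by_cases hjm : j < m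
    · simpa [hi, hjm] using hf i j hij hjm.le
    · obtain rfl | hlt : j = m ∨ m < j := by omega
      · simpa [hi, ← hfg] using hf i j hij le_rfl
      · have h1 := h i hi (j - m) (by omega) (by omega)
        simp only [hi, hjm, if_true, if_false]
        exact ⟨h1.1, fun h' => absurd h' h1.2, fun h' => by omega⟩
  · have hjm : ¬ j < m := by omega
    have h1 := hg (i - m) (j - m) (by omega) (by omega)
    simp only [hi, hjm, if_false]
    exact ⟨h1.1, h1.2.trans (by omega)⟩

/-- Appending one vertex to an induced path. -/
theorem snoc (hf : IsIndPath G f m) {w : V} (hw : G.Adj (f m) w) (hne : ∀ i ≤ m, f i ≠ w)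
    (hna : ∀ i < m, ¬ G.Adj (f i) w) :
    IsIndPath G (fun i => if i ≤ m then f i else w) (m + 1) := by
  intro i j hij hj
  have hi : i ≤ m := by omega
  by_cases hjm : j ≤ m
  · simpa [hi, hjm] using hf i j hij hjm
  · simp only [hi, hjm, if_true, if_false]
    refine ⟨hne i hi, fun h => ?_, fun h => ?_⟩
    · by_contra hcon
      exact hna i (by omega) h
    · obtain rfl : i = m := by omega
      exact hw

/-- An induced path, traversed backwards, as an embedding of a path graph. -/
theorem exists_embedding (hf : IsIndPath G f m) :
    ∃ e : pathGraph (m + 1) ↪g G, ∀ i : Fin (m + 1), e i = f (m - i) := by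
  have inj : ∀ i j : Fin (m + 1), i < j → f (m - i) ≠ f (m - j) ∧
      (G.Adj (f (m - i)) (f (m - j)) ↔ (i : ℕ) + 1 = j) := by
    intro i j hij
    have hi := i.2
    have hj := j.2
    have hij' : (i : ℕ) < j := hij
    have h := hf (m - j) (m - i) (by omega) (by omega)
    exact ⟨h.1.symm, (G.adj_comm _ _).trans (h.2.trans (by omega))⟩
  refine ⟨⟨⟨fun i => f (m - i), ?_⟩, ?_⟩, fun i => rfl⟩
  · intro i j hij
    by_contra hne
    rcases lt_or_gt_of_ne hne with h | h
    · exact (inj i j h).1 hij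
    · exact (inj j i h).1 hij.symm
  · intro i j
    change G.Adj (f (m - i)) (f (m - j)) ↔ _
    rw [pathGraph_adj]
    rcases lt_trichotomy i j with h | rfl | h
    · have h' : (i : ℕ) < j := h
      rw [(inj i j h).2]
      omega
    · simp
    · have h' : (j : ℕ) < i := h
      rw [G.adj_comm, (inj j i h).2]
      omega

end IsIndPath

theorem mem_closedNbhd_self (G : SimpleGraph V) (v : V) (n : ℕ) : v ∈ closedNbhd G v n :=
  ⟨Reachable.refl v, by simp⟩

theorem mem_closedNbhd_succ {G : SimpleGraph V} {u v w : V} {n : ℕ}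
    (h : u ∈ closedNbhd G v n) (huw : G.Adj u w) : w ∈ closedNbhd G v (n + 1) := by
  obtain ⟨p, hp⟩ := h.1.exists_walk_length_eq_dist
  refine ⟨h.1.trans huw.reachable, (dist_le (p.concat huw)).trans ?_⟩
  rw [Walk.length_concat, hp]
  exact Nat.succ_le_succ h.2

theorem closedNbhd_mono (G : SimpleGraph V) (v : V) {m n : ℕ} (h : m ≤ n) :
    closedNbhd G v m ⊆ closedNbhd G v n :=
  fun _ hu => ⟨hu.1, hu.2.trans h⟩

theorem colorableOn_closedNbhd {G : SimpleGraph V} {τ ρ : ℕ} (h : chiRho G ρ ≤ (τ : ℕ∞)) (v : V) :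
    ColorableOn G (closedNbhd G v ρ) τ :=
  (colorableOn_iff _ _ _).2
    ((le_iSup (fun v => (G.induce (closedNbhd G v ρ)).chromaticNumber) v).trans h)

theorem exists_reachIn_of_connected {G : SimpleGraph V} {D : Set V}
    (hD : (G.induce D).Connected) {x y : V} (hx : x ∈ D) (hy : y ∈ D) :
    ∃ n, ReachIn G D x y n := by
  have key : ∀ (a b : D), (G.induce D).Walk a b → ∃ n, ReachIn G D a b n := by
    intro a b p
    induction p with
    | nil => exact ⟨0, .refl _⟩
    | cons h p ih =>
      obtain ⟨n, hn⟩ := ih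
      exact ⟨1 + n, (ReachIn.step (Subtype.prop _) h).trans hn⟩
  exact key ⟨x, hx⟩ ⟨y, hy⟩ (hD ⟨x, hx⟩ ⟨y, hy⟩).some

/-- Growing a connected set `P` from `s` inside a connected set `D`, one can arrange that a large
part `C` of a given set is at distance exactly two from `P` inside `D`. -/
theorem exists_connected_part {G : SimpleGraph V} {D F : Set V} {s : V} {c : ℕ}
    (hD : (G.induce D).Connected) (hs : s ∈ D) (hFD : F ⊆ D)
    (hball : ColorableOn G (closedNbhd G s 3) c) (hF : ¬ ColorableOn G F (2 * c)) :
    ∃ P C : Set V, P ⊆ D ∧ s ∈ P ∧ (∀ p ∈ P, ∃ n, ReachIn G P s p n) ∧ C ⊆ F ∧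
      ¬ ColorableOn G C c ∧ (∀ v ∈ C, v ∉ P ∧ ∀ p ∈ P, ¬ G.Adj p v) ∧
      ∀ v ∈ C, ∃ q ∈ D, q ∉ P ∧ G.Adj v q ∧ ∃ p ∈ P, G.Adj p q := by
  classical
  have hex : ∀ v ∈ D, ∃ n, ReachIn G D s v n := fun v hv => exists_reachIn_of_connected hD hs hv
  set δ : V → ℕ := fun v => sInf {n | ReachIn G D s v n} with hδ
  have hδmem : ∀ v ∈ D, ReachIn G D s v (δ v) := fun v hv => Nat.sInf_mem (hex v hv)
  have hδle : ∀ v n, ReachIn G D s v n → δ v ≤ n := fun v n h => Nat.sInf_le h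
  have hδadj : ∀ u ∈ D, ∀ v, G.Adj u v → δ v ≤ δ u + 1 := fun u hu v huv =>
    hδle _ _ ((hδmem u hu).tail hu huv)
  have hδpred : ∀ v ∈ D, 0 < δ v → ∃ u ∈ D, G.Adj u v ∧ δ u + 1 = δ v := by
    intro v hv hpos
    obtain ⟨f, hf0, hfn, hfS, hfa⟩ := hδmem v hv
    have hadj := hfa (δ v - 1) (by omega)
    have e : δ v - 1 + 1 = δ v := by omega
    rw [e, hfn] at hadj
    have hmem := hfS (δ v - 1) (by omega)
    refine ⟨_, hmem, hadj, ?_⟩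
    have h1 := hδadj _ hmem _ hadj
    have h2 : δ (f (δ v - 1)) ≤ δ v - 1 := hδle _ _
      ⟨f, hf0, rfl, fun j hj => hfS j (by omega), fun j hj => hfa j (by omega)⟩
    omega
  have hδs : δ s = 0 := by
    have := hδle s 0 (.refl s)
    omega
  have hδ0 : ∀ v ∈ D, δ v = 0 → v = s := by
    intro v hv h
    obtain ⟨f, hf0, hfn, -⟩ := hδmem v hv
    rw [← hfn, h, hf0]
  obtain ⟨j, hj⟩ : ∃ j, ¬ ColorableOn G {v ∈ F | δ v = j} c := by
    by_contra! hcon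
    refine hF (ColorableOn.of_fibres (fun v => δ v % 2) (fun v _ => Nat.mod_lt _ (by omega)) ?_)
    intro i _
    refine ColorableOn.glue δ ?_ ?_
    · rintro u ⟨hu, hui⟩ v ⟨hv, hvi⟩ huv
      have h1 := hδadj u (hFD hu) v huv
      have h2 := hδadj v (hFD hv) u huv.symm
      omega
    · intro u _
      exact (hcon (δ u)).mono (fun v hv => ⟨hv.1.1, hv.2⟩) le_rfl
  have hj2 : 2 ≤ j := by
    by_contra hlt
    refine hj (hball.mono ?_ le_rfl)
    rintro v ⟨hv, rfl⟩
    obtain h | h : δ v = 0 ∨ δ v = 1 := by omega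
    · rw [hδ0 v (hFD hv) h]
      exact mem_closedNbhd_self G s 3
    · obtain ⟨u, hu, huv, hu1⟩ := hδpred v (hFD hv) (by omega)
      rw [hδ0 u hu (by omega)] at huv
      exact closedNbhd_mono G s (by omega) (mem_closedNbhd_succ (mem_closedNbhd_self G s 0) huv)
  refine ⟨{v ∈ D | δ v + 2 ≤ j}, {v ∈ F | δ v = j}, fun v hv => hv.1, ⟨hs, by omega⟩, ?_,
    fun v hv => hv.1, hj, ?_, ?_⟩
  · rintro p ⟨hp, hpj⟩
    obtain ⟨f, hf0, hfn, hfS, hfa⟩ := hδmem p hp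
    refine ⟨δ p, f, hf0, hfn, fun i hi => ⟨hfS i hi, ?_⟩, hfa⟩
    have := hδle (f i) i
      ⟨f, hf0, rfl, fun j hj => hfS j (by omega), fun j hj => hfa j (by omega)⟩
    omega
  · rintro v ⟨hv, hvj⟩
    refine ⟨fun h => by have := h.2; omega, ?_⟩
    rintro p ⟨hp, hpj⟩ hpv
    have := hδadj p hp v hpv
    omega
  · rintro v ⟨hv, hvj⟩
    obtain ⟨q, hq, hqv, hq1⟩ := hδpred v (hFD hv) (by omega)
    obtain ⟨p, hp, hpq, hp1⟩ := hδpred q hq (by omega)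
    exact ⟨q, hq, fun h => by have := h.2; omega, hqv.symm, p, ⟨hp, by omega⟩, hpq⟩

/-- The shower has a `d`-peripheral jet with `n` edges, listed from the drain to the head. -/
def HasPeriphJet (G : SimpleGraph V) (k : ℕ) (L : ℕ → Set V) (s : V) (d n : ℕ) : Prop :=
  ∃ g : ℕ → V, IsIndPath G g n ∧ g 0 = s ∧ g n ∈ L 0 ∧ (∀ i ≤ n, g i ∈ showerVtx k L) ∧
    ∃ X ⊆ showerFloor G k L, (∀ x ∈ X, ∀ i ≤ n, x ≠ g i ∧ ¬ G.Adj x (g i)) ∧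
      ¬ ColorableOn G X d

theorem mem_showerVtx {k : ℕ} {L : ℕ → Set V} {v : V} :
    v ∈ showerVtx k L ↔ ∃ i ≤ k, v ∈ L i := by
  simp [showerVtx]

theorem HasPeriphJet.exists_embedding {G : SimpleGraph V} {k : ℕ} {L : ℕ → Set V} {s : V}
    {d n : ℕ} (h : HasPeriphJet G k L s d n) :
    ∃ f : pathGraph (n + 1) ↪g G, IsPeriphJet G k L s d f := by
  obtain ⟨g, hg, hg0, hgn, hgS, X, hXF, hX, hXd⟩ := h
  obtain ⟨e, he⟩ := hg.exists_embedding
  refine ⟨e, ⟨?_, ?_, ?_⟩, X, hXF, ?_, ?_, (lt_chromaticNumber_iff G X d).2 hXd⟩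
  · rintro _ ⟨i, rfl⟩
    rw [he]
    exact hgS _ (Nat.sub_le _ _)
  · rw [he]
    simpa using hgn
  · rw [he]
    simpa using hg0
  · rw [Set.disjoint_left]
    rintro x hx ⟨i, rfl⟩
    exact (hX _ hx _ (Nat.sub_le _ _)).1 (he i)
  · rintro x hx _ ⟨i, rfl⟩
    rw [he]
    exact (hX _ hx _ (Nat.sub_le _ _)).2

namespace IsShower

variable {G : SimpleGraph V} {k : ℕ} {L : ℕ → Set V} {s : V}

theorem ne_of_mem (h : IsShower G k L s) {i j : ℕ} (hi : i ≤ k) (hj : j ≤ k) (hij : i ≠ j)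
    {a b : V} (ha : a ∈ L i) (hb : b ∈ L j) : a ≠ b := by
  rintro rfl
  exact Set.disjoint_left.1 (h.2.2.2.1 i hi j hj hij) ha hb

theorem exists_parent (h : IsShower G k L s) {i : ℕ} (hi : i + 1 < k) {v : V}
    (hv : v ∈ L (i + 1)) : ∃ u ∈ L i, G.Adj u v :=
  (h.2.2.2.2.1 (i + 1) (by omega) hi).2 v hv

theorem not_adj (h : IsShower G k L s) {i j : ℕ} (hj : j ≤ k) (hij : i + 1 < j) {u v : V}
    (hu : u ∈ L i) (hv : v ∈ L j) : ¬ G.Adj u v :=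
  fun huv => h.2.2.2.2.2.1 i j hj hij v hv u hu huv.symm

/-- Every vertex above the floor is joined to the head through the levels above it. -/
theorem exists_reachIn_head (h : IsShower G k L s) {Z : Set V}
    (hZ : ∀ i, i + 1 < k → L i ⊆ Z) {z : V} (hz : L 0 = {z}) :
    ∀ i < k, ∀ v ∈ L i, v ∈ Z → ∃ n, ReachIn G Z v z n := by
  intro i
  induction i with
  | zero =>
    intro _ v hv _
    rw [hz] at hv
    obtain rfl := hv
    exact ⟨0, .refl _⟩
  | succ i ih =>
    intro hi v hv hvZ
    obtain ⟨u, hu, huv⟩ := h.exists_parent hi hv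
    obtain ⟨n, hn⟩ := ih (by omega) u hu (hZ i hi hu)
    exact ⟨1 + n, (ReachIn.step hvZ huv.symm).trans hn⟩

/-- A shower whose floor has large chromatic number has more than three levels. -/
theorem three_le (h : IsShower G k L s) {τ : ℕ} (hball : ∀ v, ColorableOn G (closedNbhd G v 3) τ)
    (hF : ¬ ColorableOn G (showerFloor G k L) τ) : 3 ≤ k := by
  by_contra hlt
  obtain ⟨z, hz⟩ := h.2.2.1
  have hk := h.1
  refine hF ((hball z).mono ?_ le_rfl)
  rintro v ⟨hv, u, hu, huv⟩
  obtain rfl | rfl : k = 1 ∨ k = 2 := by omega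
  · obtain rfl : u = z := by simpa [hz] using hu
    exact closedNbhd_mono G u (by omega) (mem_closedNbhd_succ (mem_closedNbhd_self G u 0) huv)
  · obtain ⟨w, hw, hwu⟩ := h.exists_parent (i := 0) (by omega) hu
    obtain rfl : w = z := by simpa [hz] using hw
    exact closedNbhd_mono G w (by omega)
      (mem_closedNbhd_succ (mem_closedNbhd_succ (mem_closedNbhd_self G w 0) hwu) huv)

/-- A shower whose floor has large chromatic number has a peripheral jet. -/
theorem exists_hasPeriphJet (h : IsShower G k L s) {τ d : ℕ}
    (hball : ∀ v, ColorableOn G (closedNbhd G v 3) τ)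
    (hF : ¬ ColorableOn G (showerFloor G k L) (2 * (τ + (τ + (τ + d))))) :
    ∃ n, HasPeriphJet G k L s d n := by
  classical
  obtain ⟨P, C, hPD, hsP, hPreach, hCF, hCbig, hCP, hCq⟩ :=
    exists_connected_part h.2.2.2.2.2.2 h.2.1 (fun v hv => hv.1)
      ((hball s).mono subset_rfl (by omega)) hF
  obtain ⟨z, hz⟩ := h.2.2.1
  have hk := h.1
  obtain ⟨f, hf⟩ : C.Nonempty := by
    by_contra hne
    exact hCbig (ColorableOn.of_empty fun v hv => hne ⟨v, hv⟩)
  obtain ⟨q, hqD, hqP, hfq, p, hp, hpq⟩ := hCq f hf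
  obtain ⟨hfD, l, hl, hlf⟩ := hCF hf
  set Z : Set V := {w | w ∈ P ∨ w = q ∨ w = f ∨ w = l ∨ ∃ i, i + 1 < k ∧ w ∈ L i} with hZ
  have hqZ : q ∈ Z := Or.inr (Or.inl rfl)
  have hfZ : f ∈ Z := Or.inr (Or.inr (Or.inl rfl))
  have hlZ : l ∈ Z := Or.inr (Or.inr (Or.inr (Or.inl rfl)))
  have hLZ : ∀ i, i + 1 < k → L i ⊆ Z := fun i hi w hw =>
    Or.inr (Or.inr (Or.inr (Or.inr ⟨i, hi, hw⟩)))
  have hPZ : P ⊆ Z := fun w hw => Or.inl hw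
  have hreach : ∃ n, ReachIn G Z s z n := by
    obtain ⟨n1, hn1⟩ := hPreach p hp
    obtain ⟨n2, hn2⟩ := h.exists_reachIn_head hLZ hz (k - 1) (by omega) l hl hlZ
    exact ⟨_, ((((hn1.mono hPZ).tail (hPZ hp) hpq).tail hqZ hfq.symm).tail hfZ hlf.symm).trans hn2⟩
  obtain ⟨g, hg0, hgn, hgS, hgI, -⟩ :=
    (Nat.find_spec hreach).exists_isIndPath fun m hm => Nat.find_min hreach hm
  set n := Nat.find hreach
  have hzZ : z = l ∨ ∃ i, i + 1 < k ∧ z ∈ L i := by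
    by_cases hk1 : k = 1
    · subst hk1
      left
      simpa [hz, eq_comm] using hl
    · exact Or.inr ⟨0, by omega, by simp [hz]⟩
  have hgZ : ∀ i ≤ n, g i ∈ Z := by
    intro i hi
    by_cases hin : i < n
    · exact hgS i hin
    · obtain rfl : i = n := by omega
      rw [hgn]
      exact Or.inr (Or.inr (Or.inr hzZ))
  have hZshower : Z ⊆ showerVtx k L := by
    intro w hw
    rw [mem_showerVtx]
    rcases hw with hw | rfl | rfl | rfl | ⟨i, hi, hw⟩
    · exact ⟨k, le_rfl, hPD hw⟩
    · exact ⟨k, le_rfl, hqD⟩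
    · exact ⟨k, le_rfl, hfD⟩
    · exact ⟨k - 1, by omega, hl⟩
    · exact ⟨i, by omega, hw⟩
  refine ⟨n, g, hgI, hg0, by rw [hgn, hz]; rfl, fun i hi => hZshower (hgZ i hi),
    ((C \ closedNbhd G q 3) \ closedNbhd G f 3) \ closedNbhd G l 3, fun x hx => hCF hx.1.1.1, ?_,
    ColorableOn.not_diff (ColorableOn.not_diff (ColorableOn.not_diff hCbig (hball q)) (hball f))
      (hball l)⟩
  intro x hx i hi
  have hxC : x ∈ C := hx.1.1.1
  have far : ∀ a, x ∉ closedNbhd G a 3 → x ≠ a ∧ ¬ G.Adj x a := by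
    intro a ha
    refine ⟨?_, fun hadj => ha (closedNbhd_mono G a (by omega)
      (mem_closedNbhd_succ (mem_closedNbhd_self G a 0) hadj.symm))⟩
    rintro rfl
    exact ha (mem_closedNbhd_self G x 3)
  rcases hgZ i hi with hw | hw | hw | hw | ⟨j, hj, hw⟩
  · refine ⟨?_, fun hadj => (hCP x hxC).2 _ hw hadj.symm⟩
    rintro rfl
    exact (hCP _ hxC).1 hw
  · rw [hw]
    exact far q hx.1.1.2
  · rw [hw]
    exact far f hx.1.2
  · rw [hw]
    exact far l hx.2
  · exact ⟨(h.ne_of_mem (by omega) le_rfl (by omega) hw (hCF hxC).1).symm,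
      fun hadj => h.not_adj le_rfl hj hw (hCF hxC).1 hadj.symm⟩

end IsShower

/-- The levels of the shower obtained from `L 0, …, L (m + 3)` by replacing the last level by `D`
and keeping only the part of the two preceding levels that does not touch `A`. -/
def cutLevels (G : SimpleGraph V) (m : ℕ) (L : ℕ → Set V) (A D : Set V) (i : ℕ) : Set V :=
  if i = m + 3 then D
  else if i = m + 2 then {l ∈ L (m + 2) | (∀ a ∈ A, a ≠ l ∧ ¬ G.Adj a l) ∧
    ∃ b ∈ L (m + 1), (∀ a ∈ A, ¬ G.Adj a b) ∧ G.Adj b l}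
  else if i = m + 1 then {b ∈ L (m + 1) | ∀ a ∈ A, ¬ G.Adj a b}
  else L i

section cutLevels

variable {G : SimpleGraph V} {m : ℕ} {L : ℕ → Set V} {A D : Set V}

theorem cutLevels_last : cutLevels G m L A D (m + 3) = D := by
  simp [cutLevels]

theorem cutLevels_add_two : cutLevels G m L A D (m + 2) = {l ∈ L (m + 2) |
    (∀ a ∈ A, a ≠ l ∧ ¬ G.Adj a l) ∧ ∃ b ∈ L (m + 1), (∀ a ∈ A, ¬ G.Adj a b) ∧ G.Adj b l} := by
  simp [cutLevels]

theorem cutLevels_add_one :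
    cutLevels G m L A D (m + 1) = {b ∈ L (m + 1) | ∀ a ∈ A, ¬ G.Adj a b} := by
  simp [cutLevels]

theorem cutLevels_of_le {i : ℕ} (hi : i ≤ m) : cutLevels G m L A D i = L i := by
  unfold cutLevels
  rw [if_neg (by omega), if_neg (by omega), if_neg (by omega)]

theorem cutLevels_subset (hD : D ⊆ L (m + 3)) (i : ℕ) : cutLevels G m L A D i ⊆ L i := by
  unfold cutLevels
  split_ifs with h1 h2 h3
  · rwa [h1]
  · rw [h2]
    exact fun v hv => hv.1
  · rw [h3]
    exact fun v hv => hv.1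
  · exact subset_rfl

theorem IsShower.isShower_cutLevels {s v : V} (h : IsShower G (m + 3) L s) (hD : D ⊆ L (m + 3))
    (hconn : ConnectedOn G D) (hv : v ∈ D) : IsShower G (m + 3) (cutLevels G m L A D) v := by
  obtain ⟨h1, -, h2, h3, h4, h5, -⟩ := h
  have hsub := cutLevels_subset (G := G) (A := A) hD
  refine ⟨h1, ?_, ?_, ?_, ?_, ?_, ?_⟩
  · rwa [cutLevels_last]
  · rwa [cutLevels_of_le (Nat.zero_le m)]
  · exact fun i hi j hj hij => (h3 i hi j hj hij).mono (hsub i) (hsub j)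
  · intro i hi hik
    refine ⟨(h3 (i - 1) (by omega) i (by omega) (by omega)).mono (hsub _) (hsub _), ?_⟩
    intro w hw
    obtain rfl | hlt : i = m + 2 ∨ i ≤ m + 1 := by omega
    · rw [cutLevels_add_two] at hw
      obtain ⟨-, -, b, hb, hbA, hbw⟩ := hw
      refine ⟨b, ?_, hbw⟩
      have e : m + 2 - 1 = m + 1 := by omega
      rw [e, cutLevels_add_one]
      exact ⟨hb, hbA⟩
    · rw [cutLevels_of_le (by omega : i - 1 ≤ m)]
      exact (h4 i hi hik).2 w (hsub i hw)
  · exact fun i j hj hij a ha b hb => h5 i j hj hij a (hsub j ha) b (hsub i hb)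
  · rw [cutLevels_last]
    exact hconn.induce_connected ⟨v, hv⟩

theorem showerFloor_cutLevels_subset (hD : D ⊆ L (m + 3)) :
    showerFloor G (m + 3) (cutLevels G m L A D) ⊆ showerFloor G (m + 3) L := by
  rintro v ⟨hv, u, hu, huv⟩
  exact ⟨cutLevels_subset hD _ hv, u, cutLevels_subset hD _ hu, huv⟩

/-- The part of the cut shower outside its last level does not touch `A`. -/
theorem IsShower.anticomplete_cutLevels {s : V} (h : IsShower G (m + 3) L s)
    (hA : A ⊆ L (m + 3) ∪ L (m + 2)) {w : V} (hw : w ∈ showerVtx (m + 3) (cutLevels G m L A D))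
    (hwD : w ∉ D) : ∀ a ∈ A, a ≠ w ∧ ¬ G.Adj a w := by
  obtain ⟨i, hi, hwi⟩ := mem_showerVtx.1 hw
  intro a ha
  obtain rfl | rfl | rfl | hlt : i = m + 3 ∨ i = m + 2 ∨ i = m + 1 ∨ i ≤ m := by omega
  · rw [cutLevels_last] at hwi
    exact absurd hwi hwD
  · rw [cutLevels_add_two] at hwi
    exact hwi.2.1 a ha
  · rw [cutLevels_add_one] at hwi
    refine ⟨?_, hwi.2 a ha⟩
    rcases hA ha with ha | ha
    · exact h.ne_of_mem (by omega) (by omega) (by omega) ha hwi.1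
    · exact h.ne_of_mem (by omega) (by omega) (by omega) ha hwi.1
  · rw [cutLevels_of_le hlt] at hwi
    rcases hA ha with ha | ha
    · exact ⟨h.ne_of_mem (by omega) (by omega) (by omega) ha hwi,
        fun hadj => h.not_adj (by omega) (by omega) hwi ha hadj.symm⟩
    · exact ⟨h.ne_of_mem (by omega) (by omega) (by omega) ha hwi,
        fun hadj => h.not_adj (by omega) (by omega) hwi ha hadj.symm⟩

/-- A peripheral jet of the cut shower extends along an induced path in `A` that leads to its
drain. -/
theorem IsShower.hasPeriphJet_of_cutLevels {s v : V} (h : IsShower G (m + 3) L s)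
    (hA : A ⊆ L (m + 3) ∪ L (m + 2)) {X : Set V} (hD : insert v X ⊆ L (m + 3))
    (hAX : ∀ a ∈ A, ∀ x ∈ X, a ≠ x ∧ ¬ G.Adj a x) {d n r : ℕ} {ρ : ℕ → V}
    (hρ : IsIndPath G ρ r) (hρ0 : ρ 0 = s) (hρr : ρ r = v) (hρA : ∀ i < r, ρ i ∈ A)
    (hjet : HasPeriphJet G (m + 3) (cutLevels G m L A (insert v X)) v d n) :
    HasPeriphJet G (m + 3) L s d (n + r) := by
  obtain ⟨g, hg, hg0, hgn, hgS, Y, hYF, hY, hYd⟩ := hjet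
  have key : ∀ w ∈ showerVtx (m + 3) (cutLevels G m L A (insert v X)), w ≠ v →
      ∀ a ∈ A, a ≠ w ∧ ¬ G.Adj a w := by
    intro w hw hwv
    by_cases hwX : w ∈ X
    · exact fun a ha => hAX a ha w hwX
    · exact h.anticomplete_cutLevels hA hw fun h => h.elim hwv hwX
  have hglue : ρ r = g 0 := by rw [hρr, hg0]
  have hpath := hρ.trans hg hglue (by
    intro i hi j hj hj0
    refine key (g j) (hgS j hj) ?_ _ (hρA i hi)
    rw [← hg0]
    exact (hg 0 j hj0 hj).1.symm)
  refine ⟨_, add_comm r n ▸ hpath, ?_, ?_, ?_, Y,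
    hYF.trans (showerFloor_cutLevels_subset hD), ?_, hYd⟩
  · by_cases hr : 0 < r
    · simp [hr, hρ0]
    · obtain rfl : r = 0 := by omega
      simp [hg0, ← hρr, hρ0]
  · rw [cutLevels_of_le (Nat.zero_le m)] at hgn
    simpa using hgn
  · intro i hi
    rw [mem_showerVtx]
    by_cases hir : i < r
    · simp only [hir, if_true]
      rcases hA (hρA i hir) with ha | ha
      · exact ⟨_, le_rfl, ha⟩
      · exact ⟨_, by omega, ha⟩
    · simp only [hir, if_false]
      obtain ⟨j, hj, hgj⟩ := mem_showerVtx.1 (hgS (i - r) (by omega))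
      exact ⟨j, hj, cutLevels_subset hD j hgj⟩
  · intro x hx i hi
    by_cases hir : i < r
    · simp only [hir, if_true]
      have hxv : x ≠ v := by
        rw [← hg0]
        exact (hY x hx 0 (Nat.zero_le n)).1
      have h1 := key x (mem_showerVtx.2 ⟨_, le_rfl, (hYF hx).1⟩) hxv _ (hρA i hir)
      exact ⟨h1.1.symm, fun hadj => h1.2 hadj.symm⟩
    · simpa only [hir, if_false] using hY x hx (i - r) (by omega)

end cutLevels

/-- A set on which every clique is dominated by an outside vertex has smaller clique number than
the whole graph. -/
theorem cliqueNum_induce_lt [Finite V] {G : SimpleGraph V} {A : Set V}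
    (hA : ∀ K : Finset V, ↑K ⊆ A → G.IsClique K → ∃ q, ∀ a ∈ K, G.Adj a q) :
    (G.induce A).cliqueNum < G.cliqueNum := by
  classical
  have := Fintype.ofFinite V
  obtain ⟨K, hK⟩ := (G.induce A).exists_isNClique_cliqueNum
  set K' : Finset V := K.map (Function.Embedding.subtype _) with hK'
  have hclique : G.IsClique K' := by
    intro a ha b hb hab
    simp only [hK', Finset.coe_map, Set.mem_image] at ha hb
    obtain ⟨a, ha, rfl⟩ := ha
    obtain ⟨b, hb, rfl⟩ := hb
    exact hK.isClique ha hb fun h => hab (by rw [h])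
  obtain ⟨q, hq⟩ := hA K' (by
    intro a ha
    simp only [hK', Finset.coe_map, Set.mem_image] at ha
    obtain ⟨a, -, rfl⟩ := ha
    exact a.2) hclique
  have hqK : q ∉ K' := fun h => (hq q h).ne rfl
  have hins : G.IsClique (insert q K' : Finset V) := by
    rw [Finset.coe_insert, isClique_insert]
    exact ⟨hclique, fun b hb _ => (hq b hb).symm⟩
  have hcard := hins.card_le_cliqueNum
  rw [Finset.card_insert_of_notMem hqK, hK', Finset.card_map, hK.card_eq] at hcard
  omega

/-- A finite set graded by `pos` has an injective refinement of the grading. -/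
theorem exists_injective_refinement [Finite V] (pos : V → ℕ) :
    ∃ key : V → ℕ, Function.Injective key ∧ ∀ a b, pos a < pos b → key a < key b := by
  obtain ⟨n, ⟨e⟩⟩ := Finite.exists_equiv_fin V
  have hn : ∀ v : V, (e v : ℕ) < n := fun v => (e v).2
  refine ⟨fun v => pos v * n + e v, ?_, ?_⟩
  · intro a b hab
    have h1 : (pos a * n + e a) % n = e a := by
      rw [mul_comm, Nat.mul_add_mod, Nat.mod_eq_of_lt (hn a)]
    have h2 : (pos b * n + e b) % n = e b := by
      rw [mul_comm, Nat.mul_add_mod, Nat.mod_eq_of_lt (hn b)]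
    simp only at hab
    rw [hab, h2] at h1
    exact e.injective (Fin.ext h1.symm)
  · intro a b hab
    have h1 := hn a
    calc pos a * n + e a < (pos a + 1) * n := by rw [add_mul]; omega
      _ ≤ pos b * n := Nat.mul_le_mul_right n hab
      _ ≤ pos b * n + e b := Nat.le_add_right _ _

/-- Shortest paths that leave a connected set `P`. -/
theorem exists_shortest_paths {G : SimpleGraph V} {P : Set V} {s : V}
    (hP : ∀ p ∈ P, ∃ n, ReachIn G P s p n) :
    ∃ (pos : V → ℕ) (path : V → ℕ → V), ∀ q, (∃ p ∈ P, G.Adj p q) →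
      IsIndPath G (path q) (pos q) ∧ path q 0 = s ∧ path q (pos q) = q ∧
      (∀ i < pos q, path q i ∈ P) ∧
      ∀ i < pos q, ∀ l, G.Adj (path q i) l → pos l ≤ i + 1 := by
  have key : ∀ q, ∃ f : ℕ → V, (∃ p ∈ P, G.Adj p q) →
      IsIndPath G f (sInf {n | ReachIn G P s q n}) ∧ f 0 = s ∧
      f (sInf {n | ReachIn G P s q n}) = q ∧
      (∀ i < sInf {n | ReachIn G P s q n}, f i ∈ P) ∧
      ∀ i < sInf {n | ReachIn G P s q n}, ∀ l, G.Adj (f i) l →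
        sInf {n | ReachIn G P s l n} ≤ i + 1 := by
    intro q
    by_cases hq : ∃ p ∈ P, G.Adj p q
    · obtain ⟨p, hp, hpq⟩ := hq
      obtain ⟨n, hn⟩ := hP p hp
      have hmem : sInf {n | ReachIn G P s q n} ∈ {n | ReachIn G P s q n} :=
        Nat.sInf_mem ⟨n + 1, hn.tail hp hpq⟩
      obtain ⟨f, h0, h1, h2, h3, h4⟩ := ReachIn.exists_isIndPath hmem
        fun m hm h => absurd (Nat.sInf_le (s := {n | ReachIn G P s q n}) h) (by omega)
      exact ⟨f, fun _ => ⟨h3, h0, h1, h2, fun i hi l hl =>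
        Nat.sInf_le ((h4 i hi.le).tail (h2 i hi) hl)⟩⟩
    · exact ⟨fun _ => q, fun h => absurd h hq⟩
  choose path hpath using key
  exact ⟨_, path, hpath⟩

/-- Suppose every `v ∈ C` is attached to a vertex `q v`, earliest for the order `key` among all
attachment vertices adjacent to `v`. Then there is an edge `uv` in `C` with `q u` not adjacent to
`v`, followed by a connected set `X` of large chromatic number that is reached through `v` only. -/
theorem exists_edge_of_attachment [Finite V] {G : SimpleGraph V} {τ c : ℕ}
    (hball : ∀ v, ColorableOn G {u | G.Adj v u} τ)
    (hω : ∀ Y : Set V, (G.induce Y).cliqueNum < G.cliqueNum → ColorableOn G Y τ)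
    {C : Set V} {q : V → V} {key : V → ℕ} (hkey : Function.Injective key)
    (hq : ∀ v ∈ C, G.Adj v (q v))
    (hmin : ∀ v ∈ C, ∀ w ∈ C, G.Adj v (q w) → key (q v) ≤ key (q w)) [Nonempty V]
    (hbig : ¬ ColorableOn G C ((τ + (c + τ) + τ) * τ)) :
    ∃ u ∈ C, ∃ v ∈ C, G.Adj u v ∧ ¬ G.Adj (q u) v ∧ ∃ X ⊆ C, ConnectedOn G X ∧
      (∀ x ∈ X, key (q u) < key (q x) ∧ key (q v) < key (q x)) ∧ (∃ x ∈ X, G.Adj v x) ∧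
      (∀ x ∈ X, ¬ G.Adj u x) ∧ ¬ ColorableOn G X c := by
  set H : SimpleGraph V :=
    { Adj := fun u v => G.Adj u v ∧ ¬ G.Adj (q u) v ∧ ¬ G.Adj (q v) u
      symm := ⟨fun u v h => ⟨h.1.symm, h.2.2, h.2.1⟩⟩
      loopless := ⟨fun u h => G.loopless.irrefl u h.1⟩ } with hH
  have hHG : H ≤ G := fun u v h => h.1
  by_cases hHC : ColorableOn H C (τ + (c + τ) + τ)
  · exfalso
    obtain ⟨f, hf, hfadj⟩ := hHC
    refine hbig (ColorableOn.of_fibres f hf fun i _ => hω _ (cliqueNum_induce_lt ?_))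
    intro K hKA hK
    rcases K.eq_empty_or_nonempty with rfl | hne
    · exact ⟨Classical.arbitrary V, by simp⟩
    · obtain ⟨b, hb, hbmax⟩ := K.exists_max_image (fun v => key (q v)) hne
      refine ⟨q b, fun a ha => ?_⟩
      by_cases hab : a = b
      · rw [hab]
        exact hq b (hKA hb).1
      · have hadj : G.Adj a b := hK ha hb hab
        by_contra hcon
        have hab' : G.Adj (q a) b := by
          by_contra hcon'
          exact hfadj a (hKA ha).1 b (hKA hb).1 ⟨hadj, hcon', fun h => hcon h.symm⟩
            ((hKA ha).2.trans (hKA hb).2.symm)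
        have h1 := hmin b (hKA hb).1 a (hKA ha).1 hab'.symm
        have h2 := hbmax a ha
        have h3 : q a = q b := hkey (le_antisymm h2 h1)
        exact hcon (h3 ▸ hq a (hKA ha).1)
  · obtain ⟨u, hu, v, hv, huv, X, hX⟩ := exists_edge_of_grading hHG (fun v => key (q v))
      (fun i => by
        by_cases hi : ∃ v₀ ∈ C, key (q v₀) = i
        · obtain ⟨v₀, hv₀, rfl⟩ := hi
          refine (hball (q v₀)).mono ?_ le_rfl
          rintro v ⟨hv, hvv⟩
          have := hq v hv
          rw [hkey hvv] at this
          exact this.symm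
        · exact ColorableOn.of_empty fun v hv => hi ⟨v, hv⟩) hball hHC
    exact ⟨u, hu, v, hv, huv.1, huv.2.1, X, hX⟩

/-- In a shower with large floor, some cut shower with large floor has its drain joined to the old
drain by two induced paths whose lengths differ by one modulo `ℓ`. -/
theorem IsShower.exists_cutLevels [Finite V] {G : SimpleGraph V} {m : ℕ} {L : ℕ → Set V} {s : V}
    (h : IsShower G (m + 3) L s) {τ ℓ c : ℕ} (hℓ : 0 < ℓ)
    (hball : ∀ v, ColorableOn G (closedNbhd G v 3) τ)
    (hω : ∀ Y : Set V, (G.induce Y).cliqueNum < G.cliqueNum → ColorableOn G Y τ)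
    (hF : ¬ ColorableOn G (showerFloor G (m + 3) L)
      (2 * (ℓ * ((τ + ((τ + (τ + c)) + τ) + τ) * τ) + τ))) :
    ∃ (A X : Set V) (v : V), A ⊆ L (m + 3) ∪ L (m + 2) ∧ insert v X ⊆ L (m + 3) ∧
      ConnectedOn G (insert v X) ∧ (∀ a ∈ A, ∀ x ∈ X, a ≠ x ∧ ¬ G.Adj a x) ∧
      ¬ ColorableOn G (showerFloor G (m + 3) (cutLevels G m L A (insert v X))) c ∧
      ∃ (ρ : ℕ → ℕ → V) (r : ℕ → ℕ), r 1 ≡ r 0 + 1 [MOD ℓ] ∧ ∀ e < 2,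
        IsIndPath G (ρ e) (r e) ∧ ρ e 0 = s ∧ ρ e (r e) = v ∧ ∀ i < r e, ρ e i ∈ A := by
  classical
  obtain ⟨P, C₀, hPD, hsP, hPreach, hCF, hCbig, hCP, hCq⟩ :=
    exists_connected_part h.2.2.2.2.2.2 h.2.1 (fun v hv => hv.1)
      ((hball s).mono subset_rfl (Nat.le_add_left τ _)) hF
  have : Nonempty V := ⟨s⟩
  have hnbr : ∀ v, ColorableOn G {u | G.Adj v u} τ := fun v => (hball v).mono (fun u hu =>
    closedNbhd_mono G v (by omega) (mem_closedNbhd_succ (mem_closedNbhd_self G v 0) hu)) le_rfl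
  obtain ⟨pos, path, hpath⟩ := exists_shortest_paths hPreach
  obtain ⟨key, hkeyinj, hkey⟩ := exists_injective_refinement pos
  set Q : Set V := {q | q ∈ L (m + 3) ∪ L (m + 2) ∧ q ∉ P ∧ ∃ p ∈ P, G.Adj p q} with hQ
  have hqex : ∀ v ∈ C₀, ∃ q, q ∈ Q ∧ G.Adj v q ∧ ∀ q' ∈ Q, G.Adj v q' → key q ≤ key q' := by
    intro v hv
    obtain ⟨q, hqD, hqP, hvq, hpq⟩ := hCq v hv
    obtain ⟨q₀, hq₀, hq₀min⟩ := Set.exists_min_image {q | q ∈ Q ∧ G.Adj v q} key (Set.toFinite _)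
      ⟨q, ⟨Or.inl hqD, hqP, hpq⟩, hvq⟩
    exact ⟨q₀, hq₀.1, hq₀.2, fun q' h1 h2 => hq₀min q' ⟨h1, h2⟩⟩
  choose! q hqQ hvq hqmin using hqex
  obtain ⟨i₀, hi₀⟩ : ∃ i, ¬ ColorableOn G {v ∈ C₀ | pos (q v) % ℓ = i}
      ((τ + ((τ + (τ + c)) + τ) + τ) * τ) := by
    by_contra! hcon
    exact hCbig ((ColorableOn.of_fibres (fun v => pos (q v) % ℓ) (fun v _ => Nat.mod_lt _ hℓ)
      fun i _ => hcon i).mono subset_rfl (Nat.le_add_right _ _))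
  obtain ⟨u, ⟨hu, hui⟩, v, ⟨hv, hvi⟩, huv, hquv, X, hXC', hXconn, hXkey, ⟨x₀, hx₀, hvx₀⟩, huX,
    hXbig⟩ := exists_edge_of_attachment hnbr hω hkeyinj (fun v hv => hvq v hv.1)
      (fun v hv w hw hvw => hqmin v hv.1 _ (hqQ w hw.1) hvw) hi₀
  have hXC : X ⊆ C₀ := fun x hx => (hXC' hx).1
  have hC₀D : C₀ ⊆ L (m + 3) := fun x hx => (hCF hx).1
  have hQC : ∀ a ∈ Q, a ∉ C₀ := by
    rintro a ⟨-, -, p, hp, hpa⟩ haC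
    exact (hCP a haC).2 p hp hpa
  set A : Set V := {a | a = u ∨ ∃ w, (w = u ∨ w = v) ∧ ∃ i ≤ pos (q w), a = path (q w) i} with hA
  have hwC : ∀ w, (w = u ∨ w = v) → w ∈ C₀ := by
    rintro w (rfl | rfl) <;> assumption
  have hwX : ∀ w, (w = u ∨ w = v) → ∀ x ∈ X, key (q w) < key (q x) := by
    rintro w (rfl | rfl) x hx
    · exact (hXkey x hx).1
    · exact (hXkey x hx).2
  -- a vertex of one of the two paths lies in `P`, or is its last vertex
  have hpq : ∀ w ∈ C₀, ∀ i ≤ pos (q w), (i < pos (q w) ∧ path (q w) i ∈ P) ∨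
      (i = pos (q w) ∧ path (q w) i = q w) := by
    intro w hw i hi
    obtain ⟨-, -, h1, h2, -⟩ := hpath (q w) (hqQ w hw).2.2
    obtain hlt | rfl := hi.lt_or_eq
    · exact Or.inl ⟨hlt, h2 i hlt⟩
    · exact Or.inr ⟨rfl, h1⟩
  have hAL : A ⊆ L (m + 3) ∪ L (m + 2) := by
    rintro a (rfl | ⟨w, hw, i, hi, rfl⟩)
    · exact Or.inl (hC₀D hu)
    · rcases hpq w (hwC w hw) i hi with ⟨-, h1⟩ | ⟨-, h1⟩
      · exact Or.inl (hPD h1)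
      · rw [h1]
        exact (hqQ w (hwC w hw)).1
  have hAX : ∀ a ∈ A, ∀ x ∈ X, a ≠ x ∧ ¬ G.Adj a x := by
    rintro a (rfl | ⟨w, hw, i, hi, rfl⟩) x hx
    · refine ⟨?_, huX x hx⟩
      rintro rfl
      exact lt_irrefl _ (hXkey a hx).1
    · rcases hpq w (hwC w hw) i hi with ⟨-, h1⟩ | ⟨-, h1⟩
      · refine ⟨?_, (hCP x (hXC hx)).2 _ h1⟩
        intro h2
        exact (hCP x (hXC hx)).1 (h2 ▸ h1)
      · rw [h1]
        refine ⟨?_, fun hadj => ?_⟩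
        · intro h2
          exact hQC _ (hqQ w (hwC w hw)) (h2 ▸ hXC hx)
        · have h3 := hqmin x (hXC hx) _ (hqQ w (hwC w hw)) hadj.symm
          have h4 := hwX w hw x hx
          omega
  have hDL : insert v X ⊆ L (m + 3) := Set.insert_subset (hC₀D hv) (hXC.trans hC₀D)
  refine ⟨A, X, v, hAL, hDL, connectedOn_insert hXconn hx₀ hvx₀, hAX, ?_,
    fun e i => if e = 0 then (if i ≤ pos (q v) then path (q v) i else v)
      else (if i ≤ pos (q u) + 1 then (if i ≤ pos (q u) then path (q u) i else u) else v),
    fun e => if e = 0 then pos (q v) + 1 else pos (q u) + 1 + 1, ?_, ?_⟩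
  · intro hcol
    refine ColorableOn.not_diff (ColorableOn.not_diff hXbig (hball (q u))) (hball (q v))
      (hcol.mono ?_ le_rfl)
    rintro x ⟨⟨hx, hxu⟩, hxv⟩
    have hxq : ∀ w, (w = u ∨ w = v) → x ∉ closedNbhd G (q w) 3 := by
      rintro w (rfl | rfl) <;> assumption
    obtain ⟨-, l, hl, hlx⟩ := hCF (hXC hx)
    have hl' : l ∈ L (m + 2) := hl
    obtain ⟨b, hb, hbl⟩ := h.exists_parent (i := m + 1) (by omega) hl'
    have hself := fun w => mem_closedNbhd_self G (q w) 0
    -- vertices near the ends of the paths are far from `x`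
    have far : ∀ w, (w = u ∨ w = v) → ∀ y ∈ closedNbhd G (q w) 1,
        l ≠ y ∧ ¬ G.Adj y l := by
      intro w hw y hy
      refine ⟨?_, fun hyl => hxq w hw (mem_closedNbhd_succ (mem_closedNbhd_succ hy hyl) hlx)⟩
      rintro rfl
      exact hxq w hw (closedNbhd_mono G _ (by omega) (mem_closedNbhd_succ hy hlx))
    have hlA : ∀ a ∈ A, a ≠ l ∧ ¬ G.Adj a l := by
      rintro a (rfl | ⟨w, hw, i, hi, rfl⟩)
      · have h1 := far a (Or.inl rfl) a (mem_closedNbhd_succ (hself a) (hvq a hu).symm)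
        exact ⟨h1.1.symm, h1.2⟩
      · rcases hpq w (hwC w hw) i hi with ⟨hlt, h1⟩ | ⟨-, h1⟩
        · refine ⟨h.ne_of_mem (by omega) (by omega) (by omega) (hPD h1) hl', fun hadj => ?_⟩
          obtain ⟨hind, -, hlast, -, hpos⟩ := hpath (q w) (hqQ w (hwC w hw)).2.2
          have hlQ : l ∈ Q := ⟨Or.inr hl', fun hlP =>
            h.ne_of_mem (by omega) (by omega) (by omega) (hPD hlP) hl' rfl, _, h1, hadj⟩
          have h2 := hpos i hlt l hadj
          by_cases hi1 : i + 1 = pos (q w)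
          · have h3 := ((hind i (pos (q w)) hlt le_rfl).2).2 hi1
            rw [hlast] at h3
            exact (far w hw _ (mem_closedNbhd_succ (hself w) h3.symm)).2 hadj
          · have h3 := hkey l (q w) (by omega)
            have h4 := hqmin x (hXC hx) l hlQ hlx.symm
            have h5 := hwX w hw x hx
            omega
        · rw [h1]
          have h2 := far w hw (q w) (mem_closedNbhd_self G _ 1)
          exact ⟨h2.1.symm, h2.2⟩
    have hbA : ∀ a ∈ A, ¬ G.Adj a b := by
      rintro a (rfl | ⟨w, hw, i, hi, rfl⟩) hadj
      · exact h.not_adj (i := m + 1) (j := m + 3) le_rfl (by omega) hb (hC₀D hu) hadj.symm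
      · rcases hpq w (hwC w hw) i hi with ⟨-, h1⟩ | ⟨-, h1⟩
        · exact h.not_adj (i := m + 1) (j := m + 3) le_rfl (by omega) hb (hPD h1) hadj.symm
        · rw [h1] at hadj
          exact hxq w hw (mem_closedNbhd_succ (mem_closedNbhd_succ (mem_closedNbhd_succ (hself w)
            hadj) hbl) hlx)
    refine ⟨?_, l, ?_, hlx⟩
    · rw [cutLevels_last]
      exact Or.inr hx
    · have e : m + 3 - 1 = m + 2 := by omega
      rw [e, cutLevels_add_two]
      exact ⟨hl', hlA, b, hb, hbA, hbl⟩
  · have h1 : pos (q u) ≡ pos (q v) [MOD ℓ] := hui.trans hvi.symm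
    simpa using (h1.add_right 1).add_right 1
  · -- extending the path ending at `q w` by `w`
    have hext : ∀ w ∈ C₀, IsIndPath G (fun i => if i ≤ pos (q w) then path (q w) i else w)
        (pos (q w) + 1) := by
      intro w hw
      obtain ⟨hind, -, hlast, hP', -⟩ := hpath (q w) (hqQ w hw).2.2
      refine hind.snoc (by rw [hlast]; exact (hvq w hw).symm) ?_
        fun i hi => (hCP w hw).2 _ (hP' i hi)
      intro i hi h2
      rcases hpq w hw i hi with ⟨-, h1⟩ | ⟨-, h1⟩
      · exact (hCP w hw).1 (h2 ▸ h1)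
      · exact hQC _ (hqQ w hw) (by rw [← h1, h2]; exact hw)
    have hstart : ∀ w ∈ C₀, path (q w) 0 = s := fun w hw => (hpath (q w) (hqQ w hw).2.2).2.1
    intro e he
    obtain rfl | rfl : e = 0 ∨ e = 1 := by omega
    · refine ⟨by simpa using hext v hv, by simp [hstart v hv], by simp, ?_⟩
      intro i hi
      have hi' : i ≤ pos (q v) := by simpa [Nat.lt_succ_iff] using hi
      simp only [if_true, hi']
      exact Or.inr ⟨v, Or.inr rfl, i, hi', rfl⟩
    · refine ⟨?_, by simp [hstart u hu], by simp, ?_⟩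
      · have h1 := (hext u hu).snoc (w := v) (by simpa using huv) ?_ ?_
        · simpa using h1
        · intro i hi
          by_cases hi' : i ≤ pos (q u)
          · simp only [hi', if_true]
            intro h2
            rcases hpq u hu i hi' with ⟨-, h1⟩ | ⟨-, h1⟩
            · exact (hCP v hv).1 (h2 ▸ h1)
            · exact hQC _ (hqQ u hu) (h1 ▸ h2 ▸ hv)
          · simp only [hi', if_false]
            exact huv.ne
        · intro i hi
          have hi' : i ≤ pos (q u) := by omega
          simp only [hi', if_true]
          rcases hpq u hu i hi' with ⟨-, h1⟩ | ⟨-, h1⟩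
          · exact (hCP v hv).2 _ h1
          · rw [h1]
            exact hquv
      · intro i hi
        have hi1 : i ≤ pos (q u) + 1 := by simpa [Nat.lt_succ_iff] using hi
        by_cases hi' : i ≤ pos (q u)
        · simp only [hi', hi1, if_true]
          exact Or.inr ⟨u, Or.inl rfl, i, hi', rfl⟩
        · simp only [hi', hi1, if_true, if_false]
          exact Or.inl rfl

/-- A shower with large floor has peripheral jets of `t + 1` consecutive lengths modulo `ℓ`. -/
theorem exists_hasPeriphJets (τ ℓ d t : ℕ) (hℓ : 0 < ℓ) :
    ∃ c : ℕ, ∀ (V : Type) [Finite V] (G : SimpleGraph V) (k : ℕ) (L : ℕ → Set V) (s : V),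
      (∀ v, ColorableOn G (closedNbhd G v 3) τ) →
      (∀ Y : Set V, (G.induce Y).cliqueNum < G.cliqueNum → ColorableOn G Y τ) →
      IsShower G k L s → ¬ ColorableOn G (showerFloor G k L) c →
      ∃ p : ℕ → ℕ, ∀ j ≤ t, HasPeriphJet G k L s d (p j) ∧ p j ≡ p 0 + j [MOD ℓ] := by
  induction t with
  | zero =>
    refine ⟨2 * (τ + (τ + (τ + d))), fun V _ G k L s hball _ h hF => ?_⟩
    obtain ⟨n, hn⟩ := h.exists_hasPeriphJet hball hF
    refine ⟨fun _ => n, fun j hj => ⟨hn, ?_⟩⟩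
    obtain rfl : j = 0 := by omega
    exact Nat.ModEq.refl _
  | succ t ih =>
    obtain ⟨c, hc⟩ := ih
    refine ⟨2 * (ℓ * ((τ + ((τ + (τ + c)) + τ) + τ) * τ) + τ),
      fun V _ G k L s hball hω h hF => ?_⟩
    have hk := h.three_le hball fun hcol => hF (hcol.mono subset_rfl (by omega))
    obtain ⟨m, rfl⟩ : ∃ m, k = m + 3 := ⟨k - 3, by omega⟩
    obtain ⟨A, X, v, hA, hD, hconn, hAX, hF', ρ, r, hr, hρ⟩ := h.exists_cutLevels hℓ hball hω hF
    obtain ⟨p, hp⟩ := hc V G (m + 3) _ v hball hω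
      (h.isShower_cutLevels hD hconn (Set.mem_insert v X)) hF'
    have hext : ∀ e < 2, ∀ j ≤ t, HasPeriphJet G (m + 3) L s d (p j + r e) := fun e he j hj =>
      h.hasPeriphJet_of_cutLevels hA hD hAX (hρ e he).1 (hρ e he).2.1 (hρ e he).2.2.1
        (hρ e he).2.2.2 (hp j hj).1
    refine ⟨fun j => if j ≤ t then p j + r 0 else p t + r 1, fun j hj => ?_⟩
    by_cases hjt : j ≤ t
    · simp only [hjt, if_true, Nat.zero_le]
      refine ⟨hext 0 (by omega) j hjt, ?_⟩
      rw [add_right_comm]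
      exact (hp j hjt).2.add_right (r 0)
    · obtain rfl : j = t + 1 := by omega
      simp only [hjt, if_false, Nat.zero_le, if_true]
      refine ⟨hext 1 (by omega) t le_rfl, ?_⟩
      have h1 := (hp t le_rfl).2.add hr
      have e : p 0 + r 0 + (t + 1) = p 0 + t + (r 0 + 1) := by omega
      rw [e]
      exact h1

theorem stmt18 (τ ℓ : ℕ) (hℓ : 2 ≤ ℓ) (d t : ℕ) (ht1 : 1 ≤ t) (ht2 : t ≤ ℓ) :
    ∃ c : ℕ, ∀ (V : Type) [Fintype V] (G : SimpleGraph V)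
      (k : ℕ) (L : ℕ → Set V) (s : V),
      chiRho G 3 ≤ (τ : ℕ∞) →
      (∀ Y : Set V, (G.induce Y).cliqueNum < G.cliqueNum →
        (G.induce Y).chromaticNumber ≤ (τ : ℕ∞)) →
      IsShower G k L s →
      (c : ℕ∞) < (G.induce (showerFloor G k L)).chromaticNumber →
      ∃ (p : Fin t → ℕ) (f : (j : Fin t) → (pathGraph (p j + 1) ↪g G)),
        (∀ j, IsPeriphJet G k L s d (f j)) ∧
        (∀ j : Fin t, p j ≡ p ⟨0, ht1⟩ + (j : ℕ) [MOD ℓ]) := by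
  obtain ⟨c, hc⟩ := exists_hasPeriphJets τ ℓ d (t - 1) (by omega)
  refine ⟨c, fun V _ G k L s hball hω h hF => ?_⟩
  obtain ⟨p, hp⟩ := hc V G k L s (colorableOn_closedNbhd hball)
    (fun Y hY => (colorableOn_iff _ _ _).2 (hω Y hY)) h ((lt_chromaticNumber_iff _ _ _).1 hF)
  have hj : ∀ j : Fin t, (j : ℕ) ≤ t - 1 := fun j => by omega
  choose f hf using fun j : Fin t => (hp j (hj j)).1.exists_embedding
  exact ⟨fun j => p j, f, hf, fun j => (hp j (hj j)).2⟩
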